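/- Hook patterns versus axis reachability: Let σ be a turn sequence of length n > 0. Then: σ contains an up hook if and only if A(σ) contains a point (0,b) with b > 0; σ contains a down hook if and only if A(σ) contains a point (0,b) with b < 0; σ contains a right hook if and only if A(σ) contains a point (a,0) with a > 0; and σ contains a left hook if and only if A(σ) contains a point (a,0) with a < 0. -/

import Mathlib

/-- A turn: left (`L`) or right (`R`). -/
inductive Turn : Type
  | L : Turn
  | R : Turn
  deriving DecidableEq

/-- Rotation of a direction vector by 90° counterclockwise. -/
def rotCCW (d : ℤ × ℤ) : ℤ × ℤ := (-d.2, d.1)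

/-- Rotation of a direction vector by 90° clockwise. -/
def rotCW (d : ℤ × ℤ) : ℤ × ℤ := (d.2, -d.1)

/-- Unit direction of the axis-parallel segment from `u` to `v`. -/
def unitDir (u v : ℤ × ℤ) : ℤ × ℤ := ((v.1 - u.1).sign, (v.2 - u.2).sign)

/-- The set of integer points on the axis-parallel closed segment from `u` to `v`. -/
def segSet (u v : ℤ × ℤ) : Set (ℤ × ℤ) :=
  {q | min u.1 v.1 ≤ q.1 ∧ q.1 ≤ max u.1 v.1 ∧ min u.2 v.2 ≤ q.2 ∧ q.2 ≤ max u.2 v.2}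

/-- A simple rectilinear chain realizing the turn sequence `σ = σ₁⋯σₙ` (as a list,
`σ.get ⟨i, _⟩` is the `(i+1)`-st turn `σ_{i+1}`).  It consists of the points
`pts 0, …, pts (n+1)` with `pts 0 = (0,0)`; consecutive points span nondegenerate
axis-parallel segments, the first segment heads east, the chain turns left (CCW) or
right (CW) at each bend as prescribed by `σ`, and the chain is simple. -/
structure Chain (σ : List Turn) where
  pts : ℕ → ℤ × ℤ
  start_eq : pts 0 = (0, 0)
  first_seg : ∃ t : ℤ, 0 < t ∧ pts 1 = (t, 0)
  axis_parallel : ∀ i ≤ σ.length,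
    ((pts (i + 1)).1 = (pts i).1 ∧ (pts (i + 1)).2 ≠ (pts i).2) ∨
    ((pts (i + 1)).2 = (pts i).2 ∧ (pts (i + 1)).1 ≠ (pts i).1)
  turns : ∀ i, ∀ h : i < σ.length,
    unitDir (pts (i + 1)) (pts (i + 2)) =
      (if σ.get ⟨i, h⟩ = Turn.L then rotCCW else rotCW) (unitDir (pts i) (pts (i + 1)))
  simple_adj : ∀ i, i + 1 ≤ σ.length →
    segSet (pts i) (pts (i + 1)) ∩ segSet (pts (i + 1)) (pts (i + 2)) = {pts (i + 1)}
  simple_nonadj : ∀ i j, i + 1 < j → j ≤ σ.length →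
    segSet (pts i) (pts (i + 1)) ∩ segSet (pts j) (pts (j + 1)) = ∅

/-- `A(σ)`: the set of points reachable by the turn sequence `σ`. -/
def ReachSet (σ : List Turn) : Set (ℤ × ℤ) :=
  {q | ∃ C : Chain σ, C.pts (σ.length + 1) = q}

/-- The halfplane `V⁺(p)` (requires `p.1 ≠ 0` to be meaningful). -/
def Vplus (p : ℤ × ℤ) : Set (ℤ × ℤ) :=
  {q | ∃ i j : ℤ, 0 ≤ i ∧ q = (p.1 + p.1.sign * i, j)}

/-- The halfplane `H⁺(p)` (requires `p.2 ≠ 0` to be meaningful). -/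
def Hplus (p : ℤ × ℤ) : Set (ℤ × ℤ) :=
  {q | ∃ i j : ℤ, 0 ≤ j ∧ q = (i, p.2 + p.2.sign * j)}

/-- The quadrant `Q⁺(p)`. -/
def Qplus (p : ℤ × ℤ) : Set (ℤ × ℤ) := Vplus p ∩ Hplus p

/-- A staircase: consecutive turns always differ. -/
def IsStaircase (σ : List Turn) : Prop := σ.Chain' (· ≠ ·)

/-- The prefix number `δᵢ`: number of `L`s minus number of `R`s among the first `i` turns. -/
def delta (σ : List Turn) (i : ℕ) : ℤ :=
  ((σ.take i).count Turn.L : ℤ) - ((σ.take i).count Turn.R : ℤ)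

/-- The excess number `l - r` of a turn sequence. -/
def excess (σ : List Turn) : ℤ := (σ.count Turn.L : ℤ) - (σ.count Turn.R : ℤ)

/-- `σ` has a hook (two equal consecutive turns, at 1-based positions `k+1, k+2`)
whose prefix number is `≡ d (mod 4)`: `d = 0, 1, 2, 3` for right, up, left, down hooks. -/
def HasHook (σ : List Turn) (d : ℤ) : Prop :=
  ∃ k, ∃ h : k + 1 < σ.length,
    σ.get ⟨k, by omega⟩ = σ.get ⟨k + 1, h⟩ ∧ delta σ (k + 1) % 4 = d

/-- `σ` has some hook, i.e. two equal consecutive turns. -/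
def HasAnyHook (σ : List Turn) : Prop :=
  ∃ k, ∃ h : k + 1 < σ.length, σ.get ⟨k, by omega⟩ = σ.get ⟨k + 1, h⟩

/-- A set `S ⊆ ℤ²` is connected: any two points of `S` are joined by a path inside `S`
whose consecutive points are at `L¹`-distance `1`. -/
def GridConnected (S : Set (ℤ × ℤ)) : Prop :=
  ∀ p ∈ S, ∀ q ∈ S, ∃ (n : ℕ) (f : ℕ → ℤ × ℤ),
    f 0 = p ∧ f n = q ∧ (∀ i ≤ n, f i ∈ S) ∧
    ∀ i < n, |(f (i + 1)).1 - (f i).1| + |(f (i + 1)).2 - (f i).2| = 1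

/-- `q` lies on the boundary of the smallest axis-parallel bounding box of the chain `C`
(for `q` a point of the chain: it attains an extreme coordinate). -/
def OnBBoxBoundary (σ : List Turn) (C : Chain σ) (q : ℤ × ℤ) : Prop :=
  (∀ i ≤ σ.length + 1, q.1 ≤ (C.pts i).1) ∨ (∀ i ≤ σ.length + 1, (C.pts i).1 ≤ q.1) ∨
  (∀ i ≤ σ.length + 1, q.2 ≤ (C.pts i).2) ∨ (∀ i ≤ σ.length + 1, (C.pts i).2 ≤ q.2)

/-- The last segment of the chain `C` is entirely contained in one side of the smallest
axis-parallel bounding box of `C`. -/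
def LastSegOnSide (σ : List Turn) (C : Chain σ) : Prop :=
  ((C.pts σ.length).1 = (C.pts (σ.length + 1)).1 ∧
     ∀ i ≤ σ.length + 1, (C.pts σ.length).1 ≤ (C.pts i).1) ∨
  ((C.pts σ.length).1 = (C.pts (σ.length + 1)).1 ∧
     ∀ i ≤ σ.length + 1, (C.pts i).1 ≤ (C.pts σ.length).1) ∨
  ((C.pts σ.length).2 = (C.pts (σ.length + 1)).2 ∧
     ∀ i ≤ σ.length + 1, (C.pts σ.length).2 ≤ (C.pts i).2) ∨
  ((C.pts σ.length).2 = (C.pts (σ.length + 1)).2 ∧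
     ∀ i ≤ σ.length + 1, (C.pts i).2 ≤ (C.pts σ.length).2)

/-- The turn `σₘ` (1-based indexing). -/
def turnAt (σ : List Turn) (m : ℕ) : Turn := σ.getD (m - 1) Turn.L

/-- The suffix `σ_k ⋯ σ_n` contains no hook and all its prefix numbers `δᵢ`,
`k - 1 ≤ i ≤ n`, are `≡ 1` or `2 (mod 4)` (the combinatorial description of a
NW-staircase containing the endpoint). -/
def GoodSuffix (σ : List Turn) (k : ℕ) : Prop :=
  1 ≤ k ∧ k ≤ σ.length ∧
  (∀ m : ℕ, k ≤ m → m < σ.length → turnAt σ m ≠ turnAt σ (m + 1)) ∧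
  (∀ i : ℕ, k - 1 ≤ i → i ≤ σ.length → delta σ i % 4 = 1 ∨ delta σ i % 4 = 2)

open Classical in
/-- `₋ₓm₊ᵧᵖ(σ)`: taking the longest good suffix (i.e. the least `k` with
`GoodSuffix σ k`), the number of indices `i` with `k - 1 ≤ i ≤ n` and
`δᵢ ≡ 1 (mod 4)`; `0` if no good suffix exists. -/
noncomputable def mNWp (σ : List Turn) : ℕ :=
  if ∃ k, GoodSuffix σ k then
    Nat.card {i : ℕ // sInf {k | GoodSuffix σ k} - 1 ≤ i ∧ i ≤ σ.length ∧
      delta σ i % 4 = 1}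
  else 0

/-- The number of vertical segments of the chain `C` meeting the closed horizontal
segment from the origin to `(a, 0)`. -/
def verticalCrossCount (σ : List Turn) (C : Chain σ) (a : ℤ) : ℕ :=
  ((Finset.range (σ.length + 1)).filter fun i =>
    (C.pts i).1 = (C.pts (i + 1)).1 ∧
    0 ≤ (C.pts i).1 ∧ (C.pts i).1 ≤ a ∧
    min (C.pts i).2 (C.pts (i + 1)).2 ≤ 0 ∧ 0 ≤ max (C.pts i).2 (C.pts (i + 1)).2).card

/-- The unit direction of the `(i+1)`-st segment of the chain `C`. -/
def dirOf (σ : List Turn) (C : Chain σ) (i : ℕ) : ℤ × ℤ := unitDir (C.pts i) (C.pts (i + 1))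

/-- `z₁mz₂ᵒ(C)`: the number of `z₂`-segments in the maximal `(z₁,z₂)`-staircase subchain
of `C` containing the origin (the longest prefix of segments directed `z₁` or `z₂`);
`0` if no such subchain exists. -/
noncomputable def stairCountO (σ : List Turn) (C : Chain σ) (z₁ z₂ : ℤ × ℤ) : ℕ :=
  Nat.card {i : ℕ // i ≤ σ.length ∧ dirOf σ C i = z₂ ∧
    ∀ j ≤ i, dirOf σ C j = z₁ ∨ dirOf σ C j = z₂}

/-- `z₁mz₂ᵖ(C)`: the number of `z₂`-segments in the maximal `(z₁,z₂)`-staircase subchain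
of `C` containing the endpoint (the longest suffix of segments directed `z₁` or `z₂`);
`0` if no such subchain exists. -/
noncomputable def stairCountP (σ : List Turn) (C : Chain σ) (z₁ z₂ : ℤ × ℤ) : ℕ :=
  Nat.card {i : ℕ // i ≤ σ.length ∧ dirOf σ C i = z₂ ∧
    ∀ j, i ≤ j → j ≤ σ.length → dirOf σ C j = z₁ ∨ dirOf σ C j = z₂}

/-- A set of lattice points is an `x`-monotone curve: its vertical sections are intervals and it
is joined by a horizontal unit edge between any two consecutive columns. -/
structure XMonotone (P : Set (ℤ × ℤ)) : Prop where
  convex : ∀ x y₁ y₂ y, (x, y₁) ∈ P → (x, y₂) ∈ P → y₁ ≤ y → y ≤ y₂ → (x, y) ∈ P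
  edge : ∀ x₁ x₂ y₁ y₂, (x₁, y₁) ∈ P → (x₂, y₂) ∈ P → x₁ < x₂ →
    ∃ y, (x₁, y) ∈ P ∧ (x₁ + 1, y) ∈ P

/-- Some point of `P` lies vertically above some point of `Q`. -/
def IsAbove (P Q : Set (ℤ × ℤ)) : Prop := ∃ x y y', (x, y) ∈ P ∧ (x, y') ∈ Q ∧ y' < y

namespace XMonotone

variable {P Q : Set (ℤ × ℤ)}

lemma lt_of_lt_same_column (hP : XMonotone P) (hQ : XMonotone Q) (h : ∀ q ∈ P, q ∉ Q)
    {x y₁ y₂ z₁ z₂ : ℤ} (hy₁ : (x, y₁) ∈ P) (hy₂ : (x, y₂) ∈ Q) (hz₁ : (x, z₁) ∈ P)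
    (hz₂ : (x, z₂) ∈ Q) (hy : y₂ < y₁) : z₂ < z₁ := by
  by_contra! hz
  rcases le_or_gt z₁ y₂ with h₁ | h₁
  · exact h _ (hP.convex x z₁ y₁ y₂ hz₁ hy₁ h₁ hy.le) hy₂
  · exact h _ hz₁ (hQ.convex x y₂ z₂ z₁ hy₂ hz₂ h₁.le hz)

lemma lt_of_lt_right (hP : XMonotone P) (hQ : XMonotone Q) (h : ∀ q ∈ P, q ∉ Q) (n : ℕ) :
    ∀ {x y₁ y₂ z₁ z₂ : ℤ}, (x, y₁) ∈ P → (x, y₂) ∈ Q → (x + n, z₁) ∈ P →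
      (x + n, z₂) ∈ Q → y₂ < y₁ → z₂ < z₁ := by
  induction n with
  | zero =>
    intro x y₁ y₂ z₁ z₂ hy₁ hy₂ hz₁ hz₂ hy
    simp only [Nat.cast_zero, add_zero] at hz₁ hz₂
    exact hP.lt_of_lt_same_column hQ h hy₁ hy₂ hz₁ hz₂ hy
  | succ n ih =>
    intro x y₁ y₂ z₁ z₂ hy₁ hy₂ hz₁ hz₂ hy
    obtain ⟨w₁, hw₁, hw₁'⟩ := hP.edge _ _ _ _ hy₁ hz₁ (by omega)
    obtain ⟨w₂, hw₂, hw₂'⟩ := hQ.edge _ _ _ _ hy₂ hz₂ (by omega)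
    have e : x + ((n + 1 : ℕ) : ℤ) = x + 1 + n := by push_cast; ring
    rw [e] at hz₁ hz₂
    exact ih hw₁' hw₂' hz₁ hz₂ (hP.lt_of_lt_same_column hQ h hy₁ hy₂ hw₁ hw₂ hy)

/-- The vertical order of two disjoint `x`-monotone curves is the same in all common columns. -/
lemma lt_of_lt (hP : XMonotone P) (hQ : XMonotone Q) (h : ∀ q ∈ P, q ∉ Q)
    {x x' y₁ y₂ z₁ z₂ : ℤ} (hy₁ : (x, y₁) ∈ P) (hy₂ : (x, y₂) ∈ Q) (hz₁ : (x', z₁) ∈ P)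
    (hz₂ : (x', z₂) ∈ Q) (hy : y₂ < y₁) : z₂ < z₁ := by
  rcases le_total x x' with hx | hx
  · obtain ⟨n, rfl⟩ := Int.le.dest hx
    exact hP.lt_of_lt_right hQ h n hy₁ hy₂ hz₁ hz₂ hy
  · obtain ⟨n, rfl⟩ := Int.le.dest hx
    by_contra! hz
    rcases hz.lt_or_eq with hz | rfl
    · exact absurd (hQ.lt_of_lt_right hP (fun q hq hq' => h q hq' hq) n hz₂ hz₁ hy₂ hy₁ hz)
        hy.not_gt
    · exact h _ hz₁ hz₂

lemma exists_mem_column (hP : XMonotone P) (n : ℕ) :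
    ∀ {x x' y z : ℤ}, (x, y) ∈ P → (x', z) ∈ P → x + n ≤ x' → ∃ w, (x + n, w) ∈ P := by
  induction n with
  | zero => intro x x' y z h _ _; exact ⟨y, by simpa using h⟩
  | succ n ih =>
    intro x x' y z hy hz hx
    obtain ⟨w, -, hw⟩ := hP.edge _ _ _ _ hy hz (by push_cast at hx; omega)
    obtain ⟨v, hv⟩ := ih hw hz (by push_cast at hx; omega)
    exact ⟨v, by rwa [show x + ((n + 1 : ℕ) : ℤ) = x + 1 + n by push_cast; ring]⟩

/-- Finitely many disjoint bounded `x`-monotone curves admit a height function compatible with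
the vertical order. -/
lemma exists_height {P : ℕ → Set (ℤ × ℤ)} (hP : ∀ i, XMonotone (P i))
    (hd : ∀ i j, i ≠ j → ∀ q ∈ P i, q ∉ P j) (S : Finset ℕ) :
    ∀ r : ℕ → ℤ, (∀ i ∈ S, (∃ y, (r i, y) ∈ P i) ∧ ∀ q ∈ P i, q.1 ≤ r i) →
    ∃ h : ℕ → ℚ, ∀ i ∈ S, ∀ j ∈ S, i ≠ j → IsAbove (P i) (P j) → h j < h i := by
  induction S using Finset.strongInduction with
  | H S ih =>
    intro r hr
    rcases S.eq_empty_or_nonempty with rfl | hS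
    · exact ⟨0, by simp⟩
    obtain ⟨m, hm, hmin⟩ := S.exists_min_image r hS
    obtain ⟨h, hh⟩ := ih (S.erase m) (Finset.erase_ssubset hm) r
      (fun i hi => hr i (Finset.mem_of_mem_erase hi))
    obtain ⟨⟨ym, hym⟩, hmr⟩ := hr m hm
    have column : ∀ i ∈ S, ∀ x y, (x, y) ∈ P i → x ≤ r m → ∃ w, (r m, w) ∈ P i := by
      intro i hi x y hxy hx
      obtain ⟨n, hn⟩ := Int.le.dest hx
      obtain ⟨⟨y', hy'⟩, -⟩ := hr i hi
      rw [← hn]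
      exact (hP i).exists_mem_column n hxy hy' (hn ▸ hmin i hi)
    have above : ∀ i ∈ S, i ≠ m → IsAbove (P i) (P m) → ∃ w, (r m, w) ∈ P i ∧ ym < w := by
      rintro i hi him ⟨x, y, y', hy, hy', hlt⟩
      obtain ⟨w, hw⟩ := column i hi x y hy (hmr _ hy')
      exact ⟨w, hw, (hP i).lt_of_lt (hP m) (hd i m him) hy hy' hw hym hlt⟩
    have below : ∀ i ∈ S, i ≠ m → IsAbove (P m) (P i) → ∃ w, (r m, w) ∈ P i ∧ w < ym := by
      rintro i hi him ⟨x, y, y', hy, hy', hlt⟩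
      obtain ⟨w, hw⟩ := column i hi x y' hy' (hmr _ hy)
      exact ⟨w, hw, (hP m).lt_of_lt (hP i) (hd m i him.symm) hy hy' hym hw hlt⟩
    classical
    obtain ⟨c, hlo, hhi⟩ := Order.exists_between_finsets
      (((S.erase m).filter fun i => IsAbove (P m) (P i)).image h)
      (((S.erase m).filter fun i => IsAbove (P i) (P m)).image h) (by
        simp only [Finset.mem_image, Finset.mem_filter]
        rintro _ ⟨j, ⟨hj, hmj⟩, rfl⟩ _ ⟨i, ⟨hi, him⟩, rfl⟩
        rw [Finset.mem_erase] at hi hj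
        obtain ⟨w, hw, hw'⟩ := above i hi.2 hi.1 him
        obtain ⟨v, hv, hv'⟩ := below j hj.2 hj.1 hmj
        refine hh i (by simp [hi]) j (by simp [hj]) ?_ ⟨_, w, v, hw, hv, hv'.trans hw'⟩
        rintro rfl
        exact hd m i hi.1.symm _ hym ((hP i).convex _ v w ym hv hw hv'.le hw'.le))
    refine ⟨Function.update h m c, fun i hi j hj hij hab => ?_⟩
    by_cases him : i = m
    · subst him
      rw [Function.update_self, Function.update_of_ne hij.symm]
      exact hlo _ (Finset.mem_image_of_mem _ (by simp [hj, hij.symm, hab]))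
    by_cases hjm : j = m
    · subst hjm
      rw [Function.update_self, Function.update_of_ne hij]
      exact hhi _ (Finset.mem_image_of_mem _ (by simp [hi, hij, hab]))
    rw [Function.update_of_ne him, Function.update_of_ne hjm]
    exact hh i (by simp [hi, him]) j (by simp [hj, hjm]) hij hab

/-- A descending sequence of disjoint bounded `x`-monotone curves does not rise again above its
first curve. -/
lemma not_isAbove_of_descending {P : ℕ → Set (ℤ × ℤ)} (hP : ∀ i, XMonotone (P i))
    (hd : ∀ i j, i ≠ j → ∀ q ∈ P i, q ∉ P j) {B : ℤ} (hB : ∀ i, ∀ q ∈ P i, q.1 ≤ B) {K : ℕ}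
    (hK : 0 < K) (hdesc : ∀ k < K, IsAbove (P k) (P (k + 1))) : ¬ IsAbove (P K) (P 0) := by
  intro hab
  have hne : ∀ i ≤ K, ∃ x y, (x, y) ∈ P i := by
    intro i hi
    rcases hi.lt_or_eq with hi | rfl
    · obtain ⟨x, y, -, h, -⟩ := hdesc i hi
      exact ⟨x, y, h⟩
    · obtain ⟨x, y, -, h, -⟩ := hab
      exact ⟨x, y, h⟩
  have hr : ∀ i, ∃ r : ℤ, i ≤ K → (∃ y, (r, y) ∈ P i) ∧ ∀ q ∈ P i, q.1 ≤ r := by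
    intro i
    by_cases hi : i ≤ K
    · obtain ⟨x, y, hxy⟩ := hne i hi
      obtain ⟨r, hr, hr'⟩ := Int.exists_greatest_of_bdd (P := fun x => ∃ y, (x, y) ∈ P i)
        ⟨B, fun z ⟨y, hy⟩ => hB i _ hy⟩ ⟨x, y, hxy⟩
      exact ⟨r, fun _ => ⟨hr, fun q hq => hr' _ ⟨q.2, hq⟩⟩⟩
    · exact ⟨0, fun h => absurd h hi⟩
  choose r hr using hr
  obtain ⟨h, hh⟩ := exists_height hP hd (Finset.range (K + 1)) r
    (fun i hi => hr i (by simpa [Nat.lt_succ_iff] using hi))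
  have hle : ∀ k ≤ K, h k ≤ h 0 := by
    intro k
    induction k with
    | zero => simp
    | succ k ih =>
      intro hk
      exact (hh k (by simp; omega) (k + 1) (by simp; omega) (by omega) (hdesc k hk)).le.trans
        (ih (by omega))
  exact absurd (hh K (by simp) 0 (by simp) hK.ne' hab) (hle K le_rfl).not_gt

end XMonotone

/-- A horizontal unit vector. -/
def IsHorizontal (v : ℤ × ℤ) : Prop := v = (1, 0) ∨ v = (-1, 0)

/-- A vertical unit vector. -/
def IsVertical (v : ℤ × ℤ) : Prop := v = (0, 1) ∨ v = (0, -1)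

/-- A sequence of axis-parallel unit vectors whose consecutive terms are perpendicular. -/
def Alternating (d : ℕ → ℤ × ℤ) : Prop :=
  ∀ i, IsHorizontal (d i) ∧ IsVertical (d (i + 1)) ∨ IsVertical (d i) ∧ IsHorizontal (d (i + 1))

/-- The points `p 0, …, p (n + 1)` form a path whose `i`-th segment has direction `d i`, and whose
nonadjacent segments are disjoint. -/
structure IsSimplePath (n : ℕ) (d p : ℕ → ℤ × ℤ) : Prop where
  step : ∀ i ≤ n, ∃ l : ℤ, 0 < l ∧ p (i + 1) = ((p i).1 + l * (d i).1, (p i).2 + l * (d i).2)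
  disjoint : ∀ i j, i + 1 < j → j ≤ n →
    segSet (p i) (p (i + 1)) ∩ segSet (p j) (p (j + 1)) = ∅

lemma left_mem_segSet (u v : ℤ × ℤ) : u ∈ segSet u v := by
  simp [segSet]

lemma right_mem_segSet (u v : ℤ × ℤ) : v ∈ segSet u v := by
  simp [segSet]

/-- Perpendicular consecutive segments meet only in their common endpoint. -/
lemma segSet_inter_segSet_of_perp {d p : ℕ → ℤ × ℤ} (hd : Alternating d) {i : ℕ}
    (h₁ : ∃ l : ℤ, 0 < l ∧ p (i + 1) = ((p i).1 + l * (d i).1, (p i).2 + l * (d i).2))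
    (h₂ : ∃ l : ℤ, 0 < l ∧
      p (i + 2) = ((p (i + 1)).1 + l * (d (i + 1)).1, (p (i + 1)).2 + l * (d (i + 1)).2)) :
    segSet (p i) (p (i + 1)) ∩ segSet (p (i + 1)) (p (i + 2)) = {p (i + 1)} := by
  obtain ⟨l, hl, h₁⟩ := h₁
  obtain ⟨l', hl', h₂⟩ := h₂
  refine Set.Subset.antisymm ?_ (by
    rintro _ rfl
    exact ⟨right_mem_segSet _ _, left_mem_segSet _ _⟩)
  rintro ⟨x, y⟩ ⟨⟨a₁, a₂, a₃, a₄⟩, b₁, b₂, b₃, b₄⟩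
  simp only [Set.mem_singleton_iff, Prod.ext_iff] at *
  rcases hd i with ⟨h | h, h' | h'⟩ | ⟨h | h, h' | h'⟩ <;>
    simp only [h, h', mul_one, mul_zero, add_zero, mul_neg] at h₁ h₂ <;> omega

namespace XMonotone

variable {P : Set (ℤ × ℤ)}

lemma empty : XMonotone ∅ := ⟨by simp, by simp⟩

lemma singleton (q : ℤ × ℤ) : XMonotone {q} where
  convex x y₁ y₂ y h₁ h₂ h h' := by
    simp only [Set.mem_singleton_iff, Prod.ext_iff] at *
    omega
  edge x₁ x₂ y₁ y₂ h₁ h₂ h := by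
    simp only [Set.mem_singleton_iff, Prod.ext_iff] at *
    omega

lemma union_diff_singleton {u v : ℤ × ℤ} (hu : u ∈ P) (h : XMonotone (P ∪ segSet u v)) :
    XMonotone (P ∪ segSet u v \ {u}) := by
  convert h using 1
  ext q
  by_cases hq : q = u <;> simp [hq, hu]

lemma union_vertical (hP : XMonotone P) {u v : ℤ × ℤ} (hu : u ∈ P) (hv : v.1 = u.1) :
    XMonotone (P ∪ segSet u v \ {u}) := by
  have hseg : ∀ {x y}, (x, y) ∈ segSet u v → x = u.1 := by
    rintro x y ⟨h₁, h₂, -, -⟩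
    simp only [hv, min_self, max_self] at h₁ h₂
    omega
  refine union_diff_singleton hu ⟨?_, ?_⟩
  · intro x y₁ y₂ y h₁ h₂ h h'
    by_cases hx : x = u.1
    · subst hx
      rcases lt_trichotomy y u.2 with hy | rfl | hy
      · rcases h₁ with h₁ | h₁
        · exact .inl (hP.convex _ y₁ u.2 y h₁ hu h hy.le)
        · right
          simp only [segSet, Set.mem_ofPred_eq] at h₁ ⊢
          omega
      · exact .inl hu
      · rcases h₂ with h₂ | h₂
        · exact .inl (hP.convex _ u.2 y₂ y hu h₂ hy.le h')
        · right
          simp only [segSet, Set.mem_ofPred_eq] at h₂ ⊢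
          omega
    · exact .inl (hP.convex x y₁ y₂ y (h₁.resolve_right fun h => hx (hseg h))
        (h₂.resolve_right fun h => hx (hseg h)) h h')
  · have hcol : ∀ {x y}, (x, y) ∈ P ∪ segSet u v → ∃ z, (x, z) ∈ P := by
      rintro x y (h | h)
      · exact ⟨y, h⟩
      · exact ⟨u.2, by rwa [hseg h]⟩
    intro x₁ x₂ y₁ y₂ h₁ h₂ h
    obtain ⟨z₁, h₁⟩ := hcol h₁
    obtain ⟨z₂, h₂⟩ := hcol h₂
    obtain ⟨y, hy, hy'⟩ := hP.edge _ _ _ _ h₁ h₂ h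
    exact ⟨y, .inl hy, .inl hy'⟩

lemma union_horizontal (hP : XMonotone P) {u v : ℤ × ℤ} {s : ℤ} (hs : s = 1 ∨ s = -1)
    (hu : u ∈ P) (hle : ∀ q ∈ P, s * q.1 ≤ s * u.1) (hv : v.2 = u.2) (huv : s * u.1 < s * v.1) :
    XMonotone (P ∪ segSet u v \ {u}) := by
  have hseg : ∀ {x y}, (x, y) ∈ segSet u v ↔ y = u.2 ∧ s * u.1 ≤ s * x ∧ s * x ≤ s * v.1 := by
    intro x y
    simp only [segSet, Set.mem_ofPred_eq, hv, min_self, max_self]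
    rcases hs with rfl | rfl <;> omega
  refine union_diff_singleton hu ⟨?_, ?_⟩
  · have hmem : ∀ {x y z}, (x, y) ∈ P → (x, z) ∈ segSet u v → (x, z) ∈ P := by
      intro x y z h₁ h₂
      rw [hseg] at h₂
      have : (x, z) = u := by
        have := hle _ h₁
        rcases hs with rfl | rfl <;> ext <;> simp <;> simp at this <;> omega
      rwa [this]
    intro x y₁ y₂ y h₁ h₂ h h'
    rcases h₁ with h₁ | h₁ <;> rcases h₂ with h₂ | h₂
    · exact .inl (hP.convex x y₁ y₂ y h₁ h₂ h h')
    · exact .inl (hP.convex x y₁ y₂ y h₁ (hmem h₁ h₂) h h')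
    · exact .inl (hP.convex x y₁ y₂ y (hmem h₂ h₁) h₂ h h')
    · right
      rw [hseg] at *
      omega
  · have hP' : ∀ {x₁ x₂ y₁ y₂}, (x₁, y₁) ∈ P → (x₂, y₂) ∈ P → x₁ < x₂ →
        ∃ y, (x₁, y) ∈ P ∪ segSet u v ∧ (x₁ + 1, y) ∈ P ∪ segSet u v := by
      intro x₁ x₂ y₁ y₂ h₁ h₂ h
      obtain ⟨y, hy, hy'⟩ := hP.edge _ _ _ _ h₁ h₂ h
      exact ⟨y, .inl hy, .inl hy'⟩
    have hS : ∀ {x}, s * u.1 ≤ s * x → s * u.1 ≤ s * (x + 1) → s * x ≤ s * v.1 →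
        s * (x + 1) ≤ s * v.1 →
        ∃ y, (x, y) ∈ P ∪ segSet u v ∧ (x + 1, y) ∈ P ∪ segSet u v := by
      intro x h₁ h₂ h₃ h₄
      exact ⟨u.2, .inr (hseg.2 ⟨rfl, h₁, h₃⟩), .inr (hseg.2 ⟨rfl, h₂, h₄⟩)⟩
    intro x₁ x₂ y₁ y₂ h₁ h₂ h
    rcases h₁ with h₁ | h₁ <;> rcases h₂ with h₂ | h₂
    · exact hP' h₁ h₂ h
    · by_cases hx : x₁ < u.1
      · exact hP' h₁ hu hx
      · have := hle _ h₁
        rw [hseg] at h₂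
        rcases hs with rfl | rfl
        · apply hS <;> omega
        · omega
    · have := hle _ h₂
      rw [hseg] at h₁
      rcases hs with rfl | rfl
      · omega
      · by_cases hx : x₁ < u.1
        · apply hS <;> omega
        · exact hP' (by rwa [show x₁ = u.1 by omega]) h₂ h
    · rw [hseg] at h₁ h₂
      rcases hs with rfl | rfl <;> apply hS <;> omega

end XMonotone

/-- The state of a decomposition of the first `m` segments of a path into disjoint `x`-monotone
curves `P 0, …, P K`, each one below its predecessor, where the last one is being traversed in
direction `(s, 0)`. -/
structure Decomposition (d p : ℕ → ℤ × ℤ) (m K : ℕ) (s : ℤ) (P : ℕ → Set (ℤ × ℤ)) : Prop where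
  sign : s = 1 ∨ s = -1
  monotone : ∀ k, XMonotone (P k)
  disjoint : ∀ i j, i ≠ j → ∀ q ∈ P i, q ∉ P j
  bounded : ∃ B, ∀ i, ∀ q ∈ P i, q.1 ≤ B
  descending : ∀ k < K, IsAbove (P k) (P (k + 1))
  empty : ∀ k, K < k → P k = ∅
  subset : ∀ k, ∀ q ∈ P k, q = p 0 ∨ ∃ i < m, q ∈ segSet (p i) (p (i + 1))
  start_mem : p 0 ∈ P 0
  end_mem : p m ∈ P K
  extremal : ∀ q ∈ P K, s * q.1 ≤ s * (p m).1
  first : K = 0 → 0 ≤ s * (p m).1 ∧ ((p m).1 = 0 → m = 0 ∨ m = 1 ∧ IsVertical (d 0))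
  reverse : d m = (-s, 0) → ∃ k, m = k + 2 ∧ d k = (s, 0) ∧
    (d (k + 1) = (0, -1) → ∃ y, (p m).2 < y ∧ ((p m).1 - s, y) ∈ P K)
  reverse_next : IsVertical (d m) → d (m + 1) = (-s, 0) → ∃ k, m = k + 1 ∧ d k = (s, 0) ∧
    ((p m).1 - s, (p m).2) ∈ P K

lemma IsSimplePath.new_points {n : ℕ} {d p : ℕ → ℤ × ℤ} (hd : Alternating d)
    (hp : IsSimplePath n d p) {m : ℕ} (hm : m ≤ n) :
    ∀ q ∈ segSet (p m) (p (m + 1)) \ {p m},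
      ¬ (q = p 0 ∨ ∃ i < m, q ∈ segSet (p i) (p (i + 1))) := by
  have key : ∀ q ∈ segSet (p m) (p (m + 1)) \ {p m}, ∀ i < m, q ∉ segSet (p i) (p (i + 1)) := by
    rintro q ⟨hq, hq'⟩ i hi hqi
    rcases Nat.lt_or_ge (i + 1) m with h | h
    · exact (hp.disjoint i m h hm).subset ⟨hqi, hq⟩
    · obtain rfl : m = i + 1 := by omega
      exact hq' ((segSet_inter_segSet_of_perp hd (hp.step i (by omega)) (hp.step _ hm)).subset
        ⟨hqi, hq⟩)
  rintro q hq (rfl | ⟨i, hi, hqi⟩)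
  · rcases Nat.eq_zero_or_pos m with rfl | h
    · exact hq.2 rfl
    · exact key _ hq 0 h (left_mem_segSet _ _)
  · exact key q hq i hi hqi

lemma Decomposition.zero {d p : ℕ → ℤ × ℤ} (hd : Alternating d) (h0 : p 0 = (0, 0)) :
    ∃ s P, Decomposition d p 0 0 s P := by
  obtain ⟨s, hs, h1, h2⟩ : ∃ s : ℤ, (s = 1 ∨ s = -1) ∧ d 0 ≠ (-s, 0) ∧
      (IsVertical (d 0) → d 1 ≠ (-s, 0)) := by
    rcases hd 0 with ⟨h | h, -⟩ | ⟨h | h, h' | h'⟩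
    · exact ⟨1, by simp [h, IsVertical]⟩
    · exact ⟨-1, by simp [h, IsVertical]⟩
    · exact ⟨1, by simp_all⟩
    · exact ⟨-1, by simp_all⟩
    · exact ⟨1, by simp_all⟩
    · exact ⟨-1, by simp_all⟩
  refine ⟨s, fun k => if k = 0 then {p 0} else ∅, hs, ?_, ?_, ⟨0, ?_⟩, by simp, ?_, ?_, by simp,
    by simp, by simp, by simp [h0], fun h => absurd h h1, fun h h' => absurd h' (h2 h)⟩
  · intro k
    split_ifs
    · exact .singleton _
    · exact .empty
  · intro i j hij q hi hj
    split_ifs at hi hj <;> simp_all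
  · intro i q hq
    split_ifs at hq <;> simp_all
  · intro k hk
    simp [hk.ne']
  · intro k q hq
    split_ifs at hq <;> simp_all

/-- Scaling a simple path by `2` gives a simple path all of whose segments have length at
least `2`. -/
lemma IsSimplePath.double {n : ℕ} {d p : ℕ → ℤ × ℤ} (hp : IsSimplePath n d p) :
    IsSimplePath n d (fun i => (2 * (p i).1, 2 * (p i).2)) ∧
      ∀ i ≤ n, ∃ l : ℤ, 2 ≤ l ∧ ((2 * (p (i + 1)).1, 2 * (p (i + 1)).2) : ℤ × ℤ) =
        (2 * (p i).1 + l * (d i).1, 2 * (p i).2 + l * (d i).2) := by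
  have hstep : ∀ i ≤ n, ∃ l : ℤ, 2 ≤ l ∧ ((2 * (p (i + 1)).1, 2 * (p (i + 1)).2) : ℤ × ℤ) =
      (2 * (p i).1 + l * (d i).1, 2 * (p i).2 + l * (d i).2) := by
    intro i hi
    obtain ⟨l, hl, h⟩ := hp.step i hi
    exact ⟨2 * l, by omega, by rw [h]; ext <;> simp <;> ring⟩
  refine ⟨⟨fun i hi => ?_, fun i j hij hj => ?_⟩, hstep⟩
  · obtain ⟨l, hl, h⟩ := hstep i hi
    exact ⟨l, by omega, h⟩
  · rw [Set.eq_empty_iff_forall_notMem]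
    rintro q ⟨⟨h₁, h₂, h₃, h₄⟩, h₅, h₆, h₇, h₈⟩
    refine (Set.eq_empty_iff_forall_notMem.1 (hp.disjoint i j hij hj))
      (max (min (p i).1 (p (i + 1)).1) (min (p j).1 (p (j + 1)).1),
        max (min (p i).2 (p (i + 1)).2) (min (p j).2 (p (j + 1)).2)) ?_
    simp only [segSet, Set.mem_inter_iff, Set.mem_ofPred_eq]
    simp only at h₁ h₂ h₃ h₄ h₅ h₆ h₇ h₈
    omega

/-- The properties of a decomposition that hold whenever a new segment is added to one of the
curves. -/
lemma Decomposition.add_segment {n : ℕ} {d p : ℕ → ℤ × ℤ} (hd : Alternating d)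
    (hp : IsSimplePath n d p)
    (hlong : ∀ i ≤ n, ∃ l : ℤ, 2 ≤ l ∧ p (i + 1) = ((p i).1 + l * (d i).1, (p i).2 + l * (d i).2))
    {m : ℕ} (hm : m ≤ n) {K : ℕ} {s : ℤ} {P : ℕ → Set (ℤ × ℤ)} (hD : Decomposition d p m K s P) {K' : ℕ} (hK : K ≤ K') {s' : ℤ} (hs' : s' = 1 ∨ s' = -1)
    (hmono : XMonotone (P K' ∪ segSet (p m) (p (m + 1)) \ {p m}))
    (hdesc : ∀ k < K', IsAbove (P k) (P (k + 1) ∪ if k + 1 = K' then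
      segSet (p m) (p (m + 1)) \ {p m} else ∅))
    (hext : ∀ q ∈ P K', s' * q.1 ≤ s' * (p (m + 1)).1)
    (hext' : s' * (p m).1 ≤ s' * (p (m + 1)).1)
    (hfirst : K' = 0 → 0 ≤ s' * (p (m + 1)).1 ∧ ((p (m + 1)).1 = 0 → m = 0 ∧ IsVertical (d 0)))
    (hrev : d (m + 1) = (-s', 0) → ∃ k, m + 1 = k + 2 ∧ d k = (s', 0) ∧
      (d (k + 1) = (0, -1) → ∃ y, (p (m + 1)).2 < y ∧ ((p (m + 1)).1 - s', y) ∈ P K'))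
    (hrev' : IsVertical (d (m + 1)) → d (m + 2) = (-s', 0) → d m = (s', 0)) :
    ∃ P', Decomposition d p (m + 1) K' s' P' := by
  set T := segSet (p m) (p (m + 1)) \ {p m} with hT
  have hnew := hp.new_points hd hm
  obtain ⟨B, hB⟩ := hD.bounded
  obtain ⟨l, hl, hstep⟩ := hlong m hm
  have hendT : p (m + 1) ∈ T := by
    refine ⟨right_mem_segSet _ _, fun h => ?_⟩
    rw [Set.mem_singleton_iff, hstep, Prod.ext_iff] at h
    rcases hd m with ⟨h' | h', -⟩ | ⟨h' | h', -⟩ <;> simp [h'] at h <;> omega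
  have hmem : ∀ k q, q ∈ (if k = K' then P k ∪ T else P k) ↔ q ∈ P k ∨ k = K' ∧ q ∈ T := by
    intro k q
    split_ifs with h <;> simp [h]
  refine ⟨fun k => if k = K' then P k ∪ T else P k, hs', ?_, ?_,
    ⟨max B (max (p m).1 (p (m + 1)).1), ?_⟩, ?_, ?_, ?_, ?_, ?_, ?_, ?_, ?_, ?_⟩
  · intro k
    split_ifs with h
    · rwa [h]
    · exact hD.monotone k
  · intro i j hij q hi hj
    rw [hmem] at hi hj
    rcases hi with hi | hi <;> rcases hj with hj | hj
    · exact hD.disjoint i j hij q hi hj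
    · exact hnew q hj.2 (hD.subset i q hi)
    · exact hnew q hi.2 (hD.subset j q hj)
    · exact hij (hi.1.trans hj.1.symm)
  · intro i q hq
    rw [hmem] at hq
    rcases hq with hq | ⟨-, ⟨-, hq, -⟩, -⟩
    · exact (hB i q hq).trans (le_max_left _ _)
    · exact hq.trans (le_max_right _ _)
  · intro k hk
    obtain ⟨x, y, y', h₁, h₂, h⟩ := hdesc k hk
    refine ⟨x, y, y', (hmem _ _).2 (.inl h₁), (hmem _ _).2 ?_, h⟩
    rcases h₂ with h₂ | h₂
    · exact .inl h₂
    · split_ifs at h₂ with h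
      · exact .inr ⟨h, h₂⟩
      · exact absurd h₂ (Set.notMem_empty _)
  · intro k hk
    simp [hk.ne', hD.empty k (by omega)]
  · intro k q hq
    rw [hmem] at hq
    rcases hq with hq | hq
    · rcases hD.subset k q hq with h | ⟨i, hi, h⟩
      · exact .inl h
      · exact .inr ⟨i, by omega, h⟩
    · exact .inr ⟨m, by omega, hq.2.1⟩
  · exact (hmem _ _).2 (.inl hD.start_mem)
  · exact (hmem _ _).2 (.inr ⟨rfl, hendT⟩)
  · intro q hq
    rw [hmem] at hq
    rcases hq with hq | ⟨-, ⟨h₁, h₂, -⟩, -⟩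
    · exact hext q hq
    · rcases hs' with rfl | rfl <;> omega
  · intro h
    exact ⟨(hfirst h).1, fun h' => .inr (by simpa using (hfirst h).2 h')⟩
  · intro h
    obtain ⟨k, hk, hk', hk''⟩ := hrev h
    refine ⟨k, hk, hk', fun h => ?_⟩
    obtain ⟨y, hy, hy'⟩ := hk'' h
    exact ⟨y, hy, (hmem _ _).2 (.inl hy')⟩
  · intro h h'
    have hdm := hrev' h h'
    refine ⟨m, rfl, hdm, (hmem _ _).2 (.inr ⟨rfl, ?_, ?_⟩)⟩
    · simp only [hstep, hdm, segSet, Set.mem_ofPred_eq]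
      rcases hs' with rfl | rfl <;> simp <;> omega
    · simp only [hstep, hdm, Set.mem_singleton_iff, Prod.ext_iff]
      rcases hs' with rfl | rfl <;> simp <;> omega

lemma Decomposition.succ {n : ℕ} {d p : ℕ → ℤ × ℤ} (hd : Alternating d)
    (hp : IsSimplePath n d p)
    (hlong : ∀ i ≤ n, ∃ l : ℤ, 2 ≤ l ∧ p (i + 1) = ((p i).1 + l * (d i).1, (p i).2 + l * (d i).2))
    (hup : ∀ k, k + 2 ≤ n → d (k + 1) = (0, 1) → d (k + 2) ≠ -d k) {m : ℕ} (hm : m ≤ n)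
    {K : ℕ} {s : ℤ} {P : ℕ → Set (ℤ × ℤ)} (hD : Decomposition d p m K s P) :
    ∃ K' s' P', Decomposition d p (m + 1) K' s' P' := by
  obtain ⟨l, hl, hstep⟩ := hlong m hm
  have hs := hD.sign
  have hs0 : s ≠ 0 := by rcases hs with rfl | rfl <;> decide
  have hcase : d m = (s, 0) ∨ d m = (-s, 0) ∨ IsVertical (d m) := by
    rcases hd m with ⟨h | h, -⟩ | ⟨h, -⟩
    · rcases hs with rfl | rfl <;> simp [h]
    · rcases hs with rfl | rfl <;> simp [h]
    · exact .inr (.inr h)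
  rcases hcase with h | h | h
  · have hv : IsVertical (d (m + 1)) := by
      rcases hd m with ⟨-, h'⟩ | ⟨h', -⟩
      · exact h'
      · rcases h' with h' | h' <;> simp [h] at h'
    rw [h] at hstep
    have hlt : s * (p m).1 < s * (p (m + 1)).1 := by
      rw [hstep]; rcases hs with rfl | rfl <;> simp <;> omega
    refine ⟨K, s, hD.add_segment hd hp hlong hm le_rfl hs
      ((hD.monotone K).union_horizontal hs hD.end_mem hD.extremal (by simp [hstep]) hlt)
      (fun k hk => ?_) (fun q hq => (hD.extremal q hq).trans hlt.le) hlt.le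
      (fun hK => ⟨(hD.first hK).1.trans hlt.le, fun h0 => ?_⟩) (fun h' => ?_) (fun _ _ => h)⟩
    · obtain ⟨x, y, y', h₁, h₂, h⟩ := hD.descending k hk
      exact ⟨x, y, y', h₁, .inl h₂, h⟩
    · have := (hD.first hK).1
      simp [h0] at hlt
      omega
    · rcases hv with hv | hv <;> simp [hv, Prod.ext_iff, hs0] at h'
  · have hv : IsVertical (d (m + 1)) := by
      rcases hd m with ⟨-, h'⟩ | ⟨h', -⟩
      · exact h'
      · rcases h' with h' | h' <;> simp [h] at h'
    obtain ⟨k, rfl, hk, hk'⟩ := hD.reverse h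
    have hdown : d (k + 1) = (0, -1) := by
      have := hup k hm
      rcases hd (k + 1) with ⟨-, h'⟩ | ⟨h', -⟩
      · rcases h' with h' | h' <;> simp [h] at h'
      · rcases h' with h' | h'
        · exact absurd (by simp [h, hk]) (this h')
        · exact h'
    obtain ⟨y, hy, hyK⟩ := hk' hdown
    rw [h] at hstep
    have hT : segSet (p (k + 2)) (p (k + 2 + 1)) \ {p (k + 2)} =
        segSet ((p (k + 2)).1 - s, (p (k + 2)).2) (p (k + 2 + 1)) := by
      ext q
      simp only [segSet, hstep, Set.mem_sdiff, Set.mem_ofPred_eq, Set.mem_singleton_iff,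
        Prod.ext_iff]
      rcases hs with rfl | rfl <;> simp <;> omega
    have hempty := hD.empty (K + 1) (by omega)
    refine ⟨K + 1, -s, hD.add_segment hd hp hlong hm (by omega) (by omega) ?_
      (fun j hj => ?_) (by simp [hempty]) (by rw [hstep]; rcases hs with rfl | rfl <;> simp <;> omega)
      (by omega) (fun h' => ?_) (fun _ _ => h)⟩
    · rw [hempty, Set.empty_union, hT]
      have := (XMonotone.singleton ((p (k + 2)).1 - s, (p (k + 2)).2)).union_horizontal
        (s := -s) (v := p (k + 2 + 1)) (by omega) rfl (by simp) (by simp [hstep])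
        (by rw [hstep]; rcases hs with rfl | rfl <;> simp <;> omega)
      rwa [Set.union_sdiff_cancel] at this
      simpa using left_mem_segSet _ _
    · rcases Nat.lt_or_ge j K with hjK | hjK
      · obtain ⟨x, y, y', h₁, h₂, h⟩ := hD.descending j hjK
        exact ⟨x, y, y', h₁, .inl h₂, h⟩
      · obtain rfl : j = K := by omega
        refine ⟨_, _, _, hyK, .inr ?_, hy⟩
        rw [if_pos rfl, hT]
        exact left_mem_segSet _ _
    · rcases hv with hv | hv <;> simp [hv, Prod.ext_iff] at h'
  · have hh : IsHorizontal (d (m + 1)) := by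
      rcases hd m with ⟨h', -⟩ | ⟨-, h'⟩
      · rcases h with h | h <;> rcases h' with h' | h' <;> simp [h] at h'
      · exact h'
    have hx : (p (m + 1)).1 = (p m).1 := by
      rw [hstep]; rcases h with h | h <;> simp [h]
    refine ⟨K, s, hD.add_segment hd hp hlong hm le_rfl hs
      ((hD.monotone K).union_vertical hD.end_mem hx)
      (fun k hk => ?_) (by rw [hx]; exact hD.extremal) (by rw [hx])
      (fun hK => ⟨by rw [hx]; exact (hD.first hK).1, fun h0 => ?_⟩) (fun h' => ?_) (fun h' => ?_)⟩
    · obtain ⟨x, y, y', h₁, h₂, h⟩ := hD.descending k hk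
      exact ⟨x, y, y', h₁, .inl h₂, h⟩
    · rcases (hD.first hK).2 (hx ▸ h0) with h0 | ⟨hm1, hv0⟩
      · subst h0
        exact ⟨rfl, h⟩
      · subst hm1
        rcases hd 0 with ⟨h1, h2⟩ | ⟨h1, h2⟩
        · rcases hv0 with hv0 | hv0 <;> rcases h1 with h1 | h1 <;> simp [hv0] at h1
        · rcases h with h | h <;> rcases h2 with h2 | h2 <;> simp [h] at h2
    · obtain ⟨k, rfl, hk, hk'⟩ := hD.reverse_next h h'
      refine ⟨k, rfl, hk, fun hdown => ⟨_, ?_, hx ▸ hk'⟩⟩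
      rw [hstep, hdown]
      simp
      omega
    · rcases hh with hh | hh <;> rcases h' with h' | h' <;> simp [hh] at h'

/-- A path that ends vertically above its starting point has an up hook. -/
lemma IsSimplePath.exists_up_hook {n : ℕ} (hn : 0 < n) {d p : ℕ → ℤ × ℤ} (hd : Alternating d)
    (hp : IsSimplePath n d p) (h0 : p 0 = (0, 0)) {b : ℤ} (hb : 0 < b)
    (hend : p (n + 1) = (0, b)) : ∃ k, k + 2 ≤ n ∧ d (k + 1) = (0, 1) ∧ d (k + 2) = -d k := by
  by_contra! hup
  obtain ⟨hp₂, hlong⟩ := hp.double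
  set p₂ : ℕ → ℤ × ℤ := fun i => (2 * (p i).1, 2 * (p i).2) with hp₂_def
  have h0₂ : p₂ 0 = (0, 0) := by simp [hp₂_def, h0]
  have hend₂ : p₂ (n + 1) = (0, 2 * b) := by simp [hp₂_def, hend]
  have key : ∀ m ≤ n + 1, ∃ K s P, Decomposition d p₂ m K s P := by
    intro m
    induction m with
    | zero => exact fun _ => ⟨0, Decomposition.zero hd h0₂⟩
    | succ m ih =>
      intro hm
      obtain ⟨K, s, P, hD⟩ := ih (by omega)
      exact hD.succ hd hp₂ hlong hup (by omega)
  obtain ⟨K, s, P, hD⟩ := key (n + 1) le_rfl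
  obtain ⟨B, hB⟩ := hD.bounded
  rcases Nat.eq_zero_or_pos K with hK | hK
  · have := (hD.first hK).2 (by rw [hend₂])
    omega
  · refine XMonotone.not_isAbove_of_descending hD.monotone hD.disjoint hB hK hD.descending
      ⟨0, 2 * b, 0, ?_, ?_, by omega⟩
    · rw [← hend₂]; exact hD.end_mem
    · rw [← h0₂]; exact hD.start_mem

/-- The path with directions `e` whose segments grow so fast that each one leaves the bounding box
of its predecessors. -/
def spiral (e : ℕ → ℤ × ℤ) : ℕ → ℤ × ℤ
  | 0 => (0, 0)
  | i + 1 => ((spiral e i).1 + 3 ^ i * (e i).1, (spiral e i).2 + 3 ^ i * (e i).2)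

lemma spiral_bound {e : ℕ → ℤ × ℤ} (he : ∀ i, IsHorizontal (e i) ∨ IsVertical (e i)) (i : ℕ) :
    (2 * (spiral e i).1 < 3 ^ i ∧ -3 ^ i < 2 * (spiral e i).1) ∧
      (2 * (spiral e i).2 < 3 ^ i ∧ -3 ^ i < 2 * (spiral e i).2) := by
  induction i with
  | zero => simp [spiral]
  | succ i ih =>
    have h3 : (3 : ℤ) ^ (i + 1) = 3 * 3 ^ i := by ring
    rw [h3]
    simp only [spiral]
    generalize (3 : ℤ) ^ i = t at ih ⊢
    rcases he i with (h | h) | (h | h) <;> simp only [h] <;> omega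

lemma spiral_bound_of_le {e : ℕ → ℤ × ℤ} (he : ∀ i, IsHorizontal (e i) ∨ IsVertical (e i))
    {i j : ℕ} (hij : i ≤ j) :
    (2 * (spiral e i).1 < 3 ^ j ∧ -3 ^ j < 2 * (spiral e i).1) ∧
      (2 * (spiral e i).2 < 3 ^ j ∧ -3 ^ j < 2 * (spiral e i).2) := by
  have h := spiral_bound he i
  have : (3 : ℤ) ^ i ≤ 3 ^ j := pow_le_pow_right₀ (by norm_num) hij
  omega

/-- The line through the `j`-th segment of a spiral avoids all earlier nonadjacent segments. -/
lemma spiral_disjoint {e : ℕ → ℤ × ℤ} (he : ∀ i, IsHorizontal (e i) ∨ IsVertical (e i))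
    {i j : ℕ} (hij : i + 1 < j)
    (hj : IsHorizontal (e (j - 1)) ∧ IsVertical (e j) ∨ IsVertical (e (j - 1)) ∧ IsHorizontal (e j))
    {r : ℤ × ℤ} (hr : IsHorizontal (e j) → r.2 = (spiral e j).2)
    (hr' : IsVertical (e j) → r.1 = (spiral e j).1) :
    ∀ q ∈ segSet (spiral e i) (spiral e (i + 1)), q ∉ segSet (spiral e j) r := by
  obtain ⟨j, rfl⟩ : ∃ k, j = k + 1 := ⟨j - 1, by omega⟩
  rintro q ⟨a₁, a₂, a₃, a₄⟩ ⟨b₁, b₂, b₃, b₄⟩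
  have h₁ := spiral_bound_of_le he (show i ≤ j by omega)
  have h₂ := spiral_bound_of_le he (show i + 1 ≤ j by omega)
  have h₃ := spiral_bound he j
  rw [Nat.add_sub_cancel] at hj
  generalize spiral e i = u at *
  generalize spiral e (i + 1) = v at *
  simp only [spiral] at *
  generalize (3 : ℤ) ^ j = t at *
  rcases hj with ⟨h, h'⟩ | ⟨h, h'⟩
  · have := hr' h'
    rcases h with h | h <;> simp only [h] at * <;> omega
  · have := hr h'
    rcases h with h | h <;> simp only [h] at * <;> omega

/-- A direction sequence with an up hook coming from the east is realized by a path ending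
vertically above its starting point. -/
lemma exists_path_of_east_up_hook {n k : ℕ} {d : ℕ → ℤ × ℤ} (hd : Alternating d) (hk : k + 2 ≤ n)
    (h₀ : d k = (1, 0)) (h₁ : d (k + 1) = (0, 1)) (h₂ : d (k + 2) = (-1, 0)) :
    ∃ p b, p 0 = (0, 0) ∧ p (n + 1) = (0, b) ∧ 0 < b ∧ IsSimplePath n d p := by
  have hd' : ∀ i, IsHorizontal (d i) ∨ IsVertical (d i) := fun i => (hd i).imp And.left And.left
  set e : ℕ → ℤ × ℤ := fun j => -d (n - j) with he_def
  have hH : ∀ {v : ℤ × ℤ}, IsHorizontal (-v) ↔ IsHorizontal v := by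
    intro v
    simp only [IsHorizontal, Prod.ext_iff, Prod.fst_neg, Prod.snd_neg]
    omega
  have hV : ∀ {v : ℤ × ℤ}, IsVertical (-v) ↔ IsVertical v := by
    intro v
    simp only [IsVertical, Prod.ext_iff, Prod.fst_neg, Prod.snd_neg]
    omega
  have he' : ∀ i, IsHorizontal (e i) ∨ IsVertical (e i) := fun i =>
    (hd' (n - i)).imp hH.2 hV.2
  set M : ℤ := 3 ^ (n + 1) with hM
  have hM0 : 0 < M := by positivity
  have hA : ∀ i ≤ n + 1, _ := fun i hi => spiral_bound_of_le hd' hi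
  have hB : ∀ i ≤ n + 1, _ := fun i hi => spiral_bound_of_le he' hi
  rw [← hM] at hA hB
  set A := spiral d with hA_def
  set B := spiral e with hB_def
  have hBstep : ∀ i ≤ n, B (n + 1 - i) =
      ((B (n - i)).1 - 3 ^ (n - i) * (d i).1, (B (n - i)).2 - 3 ^ (n - i) * (d i).2) := by
    intro i hi
    rw [show n + 1 - i = n - i + 1 by omega, hB_def, spiral, he_def]
    simp only [show n - (n - i) = i by omega, Prod.fst_neg, Prod.snd_neg]
    ext <;> simp <;> ring
  set p : ℕ → ℤ × ℤ := fun i => if i ≤ k then A i else if i = k + 1 then (5 * M, (A k).2) else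
    if i = k + 2 then (5 * M, 10 * M + (B (n - 2 - k)).2) else
    ((B (n + 1 - i)).1, 10 * M + (B (n + 1 - i)).2) with hp_def
  have hpA : ∀ i ≤ k, p i = A i := fun i hi => by simp [hp_def, hi]
  have hp₁ : p (k + 1) = (5 * M, (A k).2) := by simp [hp_def]
  have hp₂ : p (k + 2) = (5 * M, 10 * M + (B (n - 2 - k)).2) := by simp [hp_def]
  have hpB : ∀ i, k + 3 ≤ i → p i = ((B (n + 1 - i)).1, 10 * M + (B (n + 1 - i)).2) := by
    intro i hi
    simp only [hp_def]
    rw [if_neg (by omega), if_neg (by omega), if_neg (by omega)]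
  clear_value p
  have low : ∀ i ≤ k + 1, (p i).2 ≤ M := by
    intro i hi
    rcases Nat.lt_or_ge k i with h | h
    · obtain rfl : i = k + 1 := by omega
      have := hA k (by omega)
      rw [hp₁]
      omega
    · have := hA i (by omega)
      rw [hpA i h]
      omega
  have high : ∀ i, k + 2 ≤ i → i ≤ n + 1 → 9 * M ≤ (p i).2 := by
    intro i hi hi'
    rcases hi.eq_or_lt with rfl | h
    · have := hB (n - 2 - k) (by omega)
      rw [hp₂]
      simp only
      omega
    · have := hB (n + 1 - i) (by omega)
      rw [hpB i h]
      simp only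
      omega
  have left : ∀ i ≤ n + 1, i ≤ k ∨ k + 3 ≤ i → (p i).1 ≤ M := by
    rintro i hi (h | h)
    · have := hA i (by omega)
      rw [hpA i h]
      omega
    · have := hB (n + 1 - i) (by omega)
      rw [hpB i h]
      simp only
      omega
  have hstep : ∀ i ≤ n, ∃ l : ℤ, 0 < l ∧
      p (i + 1) = ((p i).1 + l * (d i).1, (p i).2 + l * (d i).2) := by
    intro i hi
    rcases Nat.lt_or_ge i k with h | h
    · exact ⟨3 ^ i, by positivity, by rw [hpA _ h, hpA i h.le]; rfl⟩
    rcases h.eq_or_lt with rfl | h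
    · have := left k (by omega) (.inl le_rfl)
      refine ⟨5 * M - (p k).1, by omega, ?_⟩
      rw [hp₁, h₀, hpA k le_rfl]
      simp
    rcases (show k + 1 ≤ i from h).eq_or_lt with rfl | h
    · have := low (k + 1) le_rfl
      have := high (k + 2) le_rfl (by omega)
      refine ⟨(p (k + 2)).2 - (p (k + 1)).2, by omega, ?_⟩
      rw [h₁, hp₁, hp₂]
      simp
    rcases (show k + 2 ≤ i from h).eq_or_lt with rfl | h
    · have := left (k + 3) (by omega) (.inr le_rfl)
      refine ⟨5 * M - (p (k + 3)).1, by omega, ?_⟩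
      rw [h₂, hp₂, hpB (k + 3) le_rfl, show n + 1 - (k + 3) = n - 2 - k by omega]
      simp
    · refine ⟨3 ^ (n - i), by positivity, ?_⟩
      rw [hpB _ (by omega), hpB i h, hBstep i hi, show n + 1 - (i + 1) = n - i by omega]
      simp
      ring
  refine ⟨p, 10 * M, ?_, ?_, by omega, hstep, ?_⟩
  · rw [hpA 0 (by omega)]; rfl
  · rw [hpB _ (by omega), Nat.sub_self]; simp [hB_def, spiral]
  · intro i j hij hj
    rw [Set.eq_empty_iff_forall_notMem]
    rintro q ⟨hqi, hqj⟩
    by_cases hjk : j ≤ k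
    · rw [hpA i (by omega), hpA (i + 1) (by omega)] at hqi
      obtain ⟨l, -, hl⟩ := hstep j hj
      rw [hpA j hjk] at hqj hl
      refine spiral_disjoint hd' hij ?_ ?_ ?_ q hqi hqj
      · have := hd (j - 1)
        rwa [show j - 1 + 1 = j by omega] at this
      · rintro (h | h) <;> simp [hl, h, hA_def]
      · rintro (h | h) <;> simp [hl, h, hA_def]
    by_cases hik : k + 2 ≤ i
    · obtain ⟨l, -, hl⟩ := hstep i (by omega)
      rw [hpB (i + 1) (by omega), show n + 1 - (i + 1) = n - i by omega] at hqi hl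
      rw [hpB j (by omega), hpB (j + 1) (by omega), show n + 1 - j = n - j + 1 by omega,
        show n + 1 - (j + 1) = n - j by omega] at hqj
      refine spiral_disjoint (e := e) he' (i := n - j) (j := n - i) (by omega) ?_
        (r := ((p i).1, (p i).2 - 10 * M)) ?_ ?_ (q.1, q.2 - 10 * M) ?_ ?_
      · simp only [he_def, hH, hV, show n - (n - i) = i by omega,
          show n - (n - i - 1) = i + 1 by omega]
        exact (hd i).symm.imp And.symm And.symm
      · change IsHorizontal (-d (n - (n - i))) → (p i).2 - 10 * M = (B (n - i)).2
        rw [hH, show n - (n - i) = i by omega]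
        simp only [Prod.ext_iff] at hl
        rintro (h | h) <;> simp only [h] at hl <;> omega
      · change IsVertical (-d (n - (n - i))) → (p i).1 = (B (n - i)).1
        rw [hV, show n - (n - i) = i by omega]
        simp only [Prod.ext_iff] at hl
        rintro (h | h) <;> simp only [h] at hl <;> omega
      · change _ ∈ segSet (B (n - j)) (B (n - j + 1))
        simp only [segSet, Set.mem_ofPred_eq] at hqj ⊢
        omega
      · change _ ∈ segSet (B (n - i)) _
        simp only [segSet, Set.mem_ofPred_eq] at hqi ⊢
        omega
    obtain ⟨a₁, a₂, a₃, a₄⟩ := hqi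
    obtain ⟨b₁, b₂, b₃, b₄⟩ := hqj
    have x₁ : (p (k + 1)).1 = 5 * M := by rw [hp₁]
    have x₂ : (p (k + 2)).1 = 5 * M := by rw [hp₂]
    by_cases hjk' : j = k + 1
    · subst hjk'
      have := left i (by omega) (by omega)
      have := left (i + 1) (by omega) (by omega)
      simp only [x₁, x₂] at b₁ b₂
      omega
    by_cases hik' : i = k + 1
    · subst hik'
      have := left j (by omega) (by omega)
      have := left (j + 1) (by omega) (by omega)
      simp only [x₁, x₂] at a₁ a₂
      omega
    have := low i (by omega)
    have := low (i + 1) (by omega)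
    have := high j (by omega) (by omega)
    have := high (j + 1) (by omega) (by omega)
    omega

/-- The symmetries of the lattice fixing the origin: an optional swap of the coordinates, followed
by multiplication of the coordinates by `s` and `t`, which are meant to be signs. -/
def latticeSymm (f : Bool) (s t : ℤ) (q : ℤ × ℤ) : ℤ × ℤ :=
  if f then (s * q.2, t * q.1) else (s * q.1, t * q.2)

/-- The inverse of `latticeSymm f s t`. -/
def latticeSymmInv (f : Bool) (s t : ℤ) : ℤ × ℤ → ℤ × ℤ :=
  if f then latticeSymm f t s else latticeSymm f s t

section latticeSymm

variable {f : Bool} {s t : ℤ}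

lemma latticeSymmInv_latticeSymm (hs : s = 1 ∨ s = -1) (ht : t = 1 ∨ t = -1) (q : ℤ × ℤ) :
    latticeSymmInv f s t (latticeSymm f s t q) = q := by
  rcases hs with rfl | rfl <;> rcases ht with rfl | rfl <;> cases f <;>
    simp [latticeSymm, latticeSymmInv]

lemma latticeSymm_injective (hs : s = 1 ∨ s = -1) (ht : t = 1 ∨ t = -1) :
    Function.Injective (latticeSymm f s t) :=
  Function.LeftInverse.injective (latticeSymmInv_latticeSymm hs ht)

lemma latticeSymm_neg (q : ℤ × ℤ) : latticeSymm f s t (-q) = -latticeSymm f s t q := by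
  cases f <;> simp [latticeSymm]

lemma latticeSymm_mul (c : ℤ) (q : ℤ × ℤ) : latticeSymm f s t (c * q.1, c * q.2) =
    (c * (latticeSymm f s t q).1, c * (latticeSymm f s t q).2) := by
  cases f <;> simp [latticeSymm] <;> constructor <;> ring

lemma Alternating.latticeSymm {d : ℕ → ℤ × ℤ} (hd : Alternating d) (hs : s = 1 ∨ s = -1)
    (ht : t = 1 ∨ t = -1) : Alternating (latticeSymm f s t ∘ d) := by
  intro i
  rcases hd i with ⟨h | h, h' | h'⟩ | ⟨h | h, h' | h'⟩ <;>
    rcases hs with rfl | rfl <;> rcases ht with rfl | rfl <;> cases f <;>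
    simp [_root_.latticeSymm, h, h', IsHorizontal, IsVertical]

lemma latticeSymmInv_mem_segSet (hs : s = 1 ∨ s = -1) (ht : t = 1 ∨ t = -1) {u v q : ℤ × ℤ}
    (hq : q ∈ segSet (latticeSymm f s t u) (latticeSymm f s t v)) :
    latticeSymmInv f s t q ∈ segSet u v := by
  rcases hs with rfl | rfl <;> rcases ht with rfl | rfl <;> cases f <;>
    simp only [latticeSymm, latticeSymmInv, segSet, Set.mem_ofPred_eq, if_true,
      Bool.false_eq_true, if_false] at hq ⊢ <;> omega

lemma IsSimplePath.latticeSymm {n : ℕ} {d p : ℕ → ℤ × ℤ} (hp : IsSimplePath n d p)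
    (hs : s = 1 ∨ s = -1) (ht : t = 1 ∨ t = -1) :
    IsSimplePath n (latticeSymm f s t ∘ d) (latticeSymm f s t ∘ p) where
  step i hi := by
    obtain ⟨l, hl, h⟩ := hp.step i hi
    refine ⟨l, hl, ?_⟩
    simp only [Function.comp_apply, h]
    cases f <;> simp [_root_.latticeSymm] <;> constructor <;> ring
  disjoint i j hij hj := by
    rw [Set.eq_empty_iff_forall_notMem]
    rintro q ⟨hqi, hqj⟩
    exact (hp.disjoint i j hij hj).subset
      ⟨latticeSymmInv_mem_segSet hs ht hqi, latticeSymmInv_mem_segSet hs ht hqj⟩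

end latticeSymm

/-- A path in an alternating direction sequence can end on the open ray from its starting point in
direction `u` if and only if there is a hook in direction `u`. -/
lemma exists_hook_iff_exists_path {n : ℕ} (hn : 0 < n) {d : ℕ → ℤ × ℤ} (hd : Alternating d)
    {u : ℤ × ℤ} (hu : IsHorizontal u ∨ IsVertical u) :
    (∃ k, k + 2 ≤ n ∧ d (k + 1) = u ∧ d (k + 2) = -d k) ↔
      ∃ c : ℤ, 0 < c ∧ ∃ p, p 0 = (0, 0) ∧ p (n + 1) = (c * u.1, c * u.2) ∧
        IsSimplePath n d p := by
  constructor
  · rintro ⟨k, hk, rfl, hk'⟩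
    obtain ⟨f, s, t, hs, ht, h₀, h₁⟩ : ∃ f s t, (s = 1 ∨ s = -1) ∧ (t = 1 ∨ t = -1) ∧
        latticeSymm f s t (d k) = (1, 0) ∧ latticeSymm f s t (d (k + 1)) = (0, 1) := by
      rcases hd k with ⟨h | h, h' | h'⟩ | ⟨h | h, h' | h'⟩ <;> rw [h, h']
      · exact ⟨false, 1, 1, by simp [latticeSymm]⟩
      · exact ⟨false, 1, -1, by simp [latticeSymm]⟩
      · exact ⟨false, -1, 1, by simp [latticeSymm]⟩
      · exact ⟨false, -1, -1, by simp [latticeSymm]⟩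
      · exact ⟨true, 1, 1, by simp [latticeSymm]⟩
      · exact ⟨true, 1, -1, by simp [latticeSymm]⟩
      · exact ⟨true, -1, 1, by simp [latticeSymm]⟩
      · exact ⟨true, -1, -1, by simp [latticeSymm]⟩
    have hinv := latticeSymmInv_latticeSymm (f := f) hs ht
    obtain ⟨p, b, hp0, hpn, hb, hp⟩ := exists_path_of_east_up_hook
      (d := latticeSymm f s t ∘ d) (hd.latticeSymm hs ht) hk h₀ h₁ (by
        simp only [Function.comp_apply, hk', latticeSymm_neg, h₀]; simp)
    have hmap : IsSimplePath n d (latticeSymmInv f s t ∘ p) := by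
      have hd_eq : d = latticeSymmInv f s t ∘ latticeSymm f s t ∘ d := by
        ext1 i
        exact (hinv (d i)).symm
      rw [hd_eq]
      unfold latticeSymmInv
      split_ifs
      · exact hp.latticeSymm ht hs
      · exact hp.latticeSymm hs ht
    refine ⟨b, hb, _, ?_, ?_, hmap⟩
    · simp only [Function.comp_apply, hp0, latticeSymmInv]
      split_ifs <;> simp [latticeSymm]
    · rw [Function.comp_apply, hpn, ← hinv (b * (d (k + 1)).1, b * (d (k + 1)).2),
        latticeSymm_mul, h₁]
      simp
  · rintro ⟨c, hc, p, hp0, hpn, hp⟩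
    obtain ⟨f, s, t, hs, ht, h⟩ : ∃ f s t, (s = 1 ∨ s = -1) ∧ (t = 1 ∨ t = -1) ∧
        latticeSymm f s t u = (0, 1) := by
      rcases hu with (rfl | rfl) | (rfl | rfl)
      · exact ⟨true, 1, 1, by simp [latticeSymm]⟩
      · exact ⟨true, 1, -1, by simp [latticeSymm]⟩
      · exact ⟨false, 1, 1, by simp [latticeSymm]⟩
      · exact ⟨false, 1, -1, by simp [latticeSymm]⟩
    obtain ⟨k, hk, hk₁, hk₂⟩ := IsSimplePath.exists_up_hook hn
      (hd.latticeSymm (f := f) hs ht) (hp.latticeSymm hs ht)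
      (by simp [hp0, latticeSymm]) hc (by simp [hpn, latticeSymm_mul, h])
    have hinj := latticeSymm_injective (f := f) hs ht
    refine ⟨k, hk, hinj (hk₁.trans h.symm), hinj ?_⟩
    rw [latticeSymm_neg]
    exact hk₂

/-- The direction of the `i`-th segment of a chain realizing `σ`. -/
def direction (σ : List Turn) : ℕ → ℤ × ℤ
  | 0 => (1, 0)
  | i + 1 => (if σ.getD i Turn.L = Turn.L then rotCCW else rotCW) (direction σ i)

lemma isHorizontal_or_isVertical_direction (σ : List Turn) (i : ℕ) :
    IsHorizontal (direction σ i) ∨ IsVertical (direction σ i) := by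
  induction i with
  | zero => simp [direction, IsHorizontal]
  | succ i ih =>
    rw [direction]
    split_ifs <;> rcases ih with (h | h) | (h | h) <;>
      simp [h, rotCCW, rotCW, IsHorizontal, IsVertical]

lemma alternating_direction (σ : List Turn) : Alternating (direction σ) := by
  intro i
  rw [direction]
  split_ifs <;> rcases isHorizontal_or_isVertical_direction σ i with (h | h) | (h | h) <;>
    simp [h, rotCCW, rotCW, IsHorizontal, IsVertical]

lemma delta_succ {σ : List Turn} {i : ℕ} (hi : i < σ.length) :
    delta σ (i + 1) = delta σ i + if σ.getD i Turn.L = Turn.L then 1 else -1 := by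
  rw [delta, delta, List.take_succ_eq_append_getElem hi, List.getD_eq_getElem _ _ hi]
  rcases h : σ[i] <;> simp <;> ring

lemma delta_direction {σ : List Turn} {i : ℕ} (hi : i ≤ σ.length) :
    delta σ i % 4 = 0 ∧ direction σ i = (1, 0) ∨ delta σ i % 4 = 1 ∧ direction σ i = (0, 1) ∨
      delta σ i % 4 = 2 ∧ direction σ i = (-1, 0) ∨
      delta σ i % 4 = 3 ∧ direction σ i = (0, -1) := by
  induction i with
  | zero => simp [delta, direction]
  | succ i ih =>
    rw [delta_succ hi, direction]
    split_ifs <;> rcases ih (by omega) with ⟨h, h'⟩ | ⟨h, h'⟩ | ⟨h, h'⟩ | ⟨h, h'⟩ <;>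
      simp [h', rotCCW, rotCW] <;> omega

lemma direction_add_two_eq_neg_iff {σ : List Turn} {k : ℕ} :
    direction σ (k + 2) = -direction σ k ↔ σ.getD k Turn.L = σ.getD (k + 1) Turn.L := by
  rw [direction, direction]
  rcases σ.getD k Turn.L <;> rcases σ.getD (k + 1) Turn.L <;>
    rcases isHorizontal_or_isVertical_direction σ k with (h | h) | (h | h) <;>
    simp [h, rotCCW, rotCW]

lemma hasHook_iff {σ : List Turn} {r : ℤ} {u : ℤ × ℤ}
    (hru : ∀ i ≤ σ.length, delta σ i % 4 = r ↔ direction σ i = u) :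
    HasHook σ r ↔ ∃ k, k + 2 ≤ σ.length ∧ direction σ (k + 1) = u ∧
      direction σ (k + 2) = -direction σ k := by
  simp only [direction_add_two_eq_neg_iff]
  constructor
  · rintro ⟨k, hk, h, h'⟩
    refine ⟨k, hk, (hru _ hk.le).1 h', ?_⟩
    rwa [List.getD_eq_getElem _ _ hk, List.getD_eq_getElem _ _ (by omega : k < σ.length)]
  · rintro ⟨k, hk, h, h'⟩
    rw [List.getD_eq_getElem _ _ hk, List.getD_eq_getElem _ _ (by omega : k < σ.length)] at h'
    exact ⟨k, hk, h', (hru _ (by omega)).2 h⟩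

lemma exists_step_iff_unitDir_eq {u v e : ℤ × ℤ} (he : IsHorizontal e ∨ IsVertical e) :
    (∃ l : ℤ, 0 < l ∧ v = (u.1 + l * e.1, u.2 + l * e.2)) ↔ unitDir u v = e := by
  constructor
  · rintro ⟨l, hl, rfl⟩
    rcases he with (rfl | rfl) | (rfl | rfl) <;> simp [unitDir, hl, Int.sign_eq_one_of_pos]
  · intro h
    rw [unitDir, Prod.ext_iff] at h
    refine ⟨|v.1 - u.1| + |v.2 - u.2|, ?_, ?_⟩ <;>
      rcases he with (rfl | rfl) | (rfl | rfl) <;>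
      simp only [Int.sign_eq_one_iff_pos, Int.sign_eq_neg_one_iff_neg, Int.sign_eq_zero_iff_zero,
        Prod.ext_iff] at h ⊢ <;>
      grind

lemma mem_reachSet_iff {σ : List Turn} {q : ℤ × ℤ} :
    q ∈ ReachSet σ ↔ ∃ p, p 0 = (0, 0) ∧ p (σ.length + 1) = q ∧
      IsSimplePath σ.length (direction σ) p := by
  constructor
  · rintro ⟨C, hC⟩
    have hdir : ∀ i ≤ σ.length, unitDir (C.pts i) (C.pts (i + 1)) = direction σ i := by
      intro i
      induction i with
      | zero =>
        obtain ⟨t, ht, h⟩ := C.first_seg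
        intro _
        rw [zero_add, h, C.start_eq]
        simp [unitDir, direction, Int.sign_eq_one_of_pos ht]
      | succ i ih =>
        intro hi
        rw [C.turns i hi, ih (by omega), direction, List.getD_eq_getElem _ _ hi]
        rfl
    exact ⟨C.pts, C.start_eq, hC, fun i hi =>
      (exists_step_iff_unitDir_eq (isHorizontal_or_isVertical_direction σ i)).2 (hdir i hi),
      C.simple_nonadj⟩
  · rintro ⟨p, hp0, hpn, hp⟩
    have hdir : ∀ i ≤ σ.length, unitDir (p i) (p (i + 1)) = direction σ i := fun i hi =>
      (exists_step_iff_unitDir_eq (isHorizontal_or_isVertical_direction σ i)).1 (hp.step i hi)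
    refine ⟨⟨p, hp0, ?_, ?_, ?_, ?_, hp.disjoint⟩, hpn⟩
    · obtain ⟨l, hl, h⟩ := hp.step 0 (by omega)
      exact ⟨l, hl, by simpa [hp0, direction] using h⟩
    · intro i hi
      obtain ⟨l, hl, h⟩ := hp.step i hi
      rw [h]
      rcases isHorizontal_or_isVertical_direction σ i with (h | h) | (h | h) <;>
        simp [h] <;> omega
    · intro i hi
      rw [hdir (i + 1) hi, hdir i hi.le, direction, List.getD_eq_getElem _ _ hi]
      rfl
    · intro i hi
      exact segSet_inter_segSet_of_perp (alternating_direction σ) (hp.step i (by omega))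
        (hp.step (i + 1) hi)

lemma hasHook_iff_exists_mem_reachSet {σ : List Turn} (hn : 0 < σ.length) {r : ℤ} {u : ℤ × ℤ}
    (hu : IsHorizontal u ∨ IsVertical u)
    (hru : ∀ i ≤ σ.length, delta σ i % 4 = r ↔ direction σ i = u) :
    HasHook σ r ↔ ∃ c : ℤ, 0 < c ∧ (c * u.1, c * u.2) ∈ ReachSet σ := by
  simp only [hasHook_iff hru, exists_hook_iff_exists_path hn (alternating_direction σ) hu,
    mem_reachSet_iff]

/-- **Hook patterns versus axis reachability.** For a nonempty turn sequence `σ`: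
`σ` has an up hook iff `A(σ)` meets the `+y`-axis, a down hook iff it meets the
`-y`-axis, a right hook iff it meets the `+x`-axis, and a left hook iff it meets
the `-x`-axis. -/
theorem hook_iff_axis_reachable (σ : List Turn) (hn : 0 < σ.length) :
    (HasHook σ 1 ↔ ∃ b : ℤ, 0 < b ∧ ((0 : ℤ), b) ∈ ReachSet σ) ∧
    (HasHook σ 3 ↔ ∃ b : ℤ, b < 0 ∧ ((0 : ℤ), b) ∈ ReachSet σ) ∧
    (HasHook σ 0 ↔ ∃ a : ℤ, 0 < a ∧ (a, (0 : ℤ)) ∈ ReachSet σ) ∧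
    (HasHook σ 2 ↔ ∃ a : ℤ, a < 0 ∧ (a, (0 : ℤ)) ∈ ReachSet σ) := by
  have neg_iff : ∀ p : ℤ → Prop, (∃ c : ℤ, 0 < c ∧ p (-c)) ↔ ∃ b : ℤ, b < 0 ∧ p b := fun p =>
    ⟨fun ⟨c, hc, h⟩ => ⟨-c, by omega, h⟩, fun ⟨b, hb, h⟩ => ⟨-b, by omega, by rwa [neg_neg]⟩⟩
  refine ⟨?_, ?_, ?_, ?_⟩
  · rw [hasHook_iff_exists_mem_reachSet hn (u := (0, 1)) (by simp [IsVertical])]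
    · simp
    · intro i hi
      rcases delta_direction hi with h | h | h | h <;> simp [h]
  · rw [hasHook_iff_exists_mem_reachSet hn (u := (0, -1)) (by simp [IsVertical]), ← neg_iff]
    · simp
    · intro i hi
      rcases delta_direction hi with h | h | h | h <;> simp [h]
  · rw [hasHook_iff_exists_mem_reachSet hn (u := (1, 0)) (by simp [IsHorizontal])]
    · simp
    · intro i hi
      rcases delta_direction hi with h | h | h | h <;> simp [h]
  · rw [hasHook_iff_exists_mem_reachSet hn (u := (-1, 0)) (by simp [IsHorizontal]), ← neg_iff]
    · simp
    · intro i hi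
      rcases delta_direction hi with h | h | h | h <;> simp [h]
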